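/- arXiv:2209.02762 — 3 statements merged into one kernel-verified Lean document; each statement's English description precedes it below -/
import Mathlib

section
/- Fix a nonempty finite index set S, claim rates c : S → ℝ, and distances d : S → ℝ with d s ≥ 0 for every s. Let M = {s ∈ S : d s = min_{t∈S} d t} be the (nonempty) set of training samples at minimal distance from the test sample. Then the predicted claim rate ĉ(κ) = (∑_{s∈S} c s/(1+d s)^κ) / (∑_{s∈S} 1/(1+d s)^κ) converges, as κ → ∞, to the arithmetic mean (∑_{s∈M} c s)/|M| of the claim rates of the samples in M. -/
open Filter

/-- If `m` is a lower bound of `d` on `S`, then after rescaling by `(1 + m) ^ κ` a sum weighted by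
`(1 + d s) ^ (-κ)` converges to the unweighted sum over the points where `d` equals `m`. -/
theorem tendsto_rpow_mul_sum_div_rpow {ι : Type*} (S : Finset ι) (a d : ι → ℝ) (m : ℝ)
    (hm : 0 ≤ m) (hmd : ∀ s ∈ S, m ≤ d s) :
    Tendsto (fun κ : ℝ => (1 + m) ^ κ * ∑ s ∈ S, a s / (1 + d s) ^ κ)
      atTop (nhds (∑ s ∈ S.filter (fun s => d s = m), a s)) := by
  simp_rw [Finset.mul_sum, Finset.sum_filter]
  refine tendsto_finsetSum _ fun s hs => ?_
  have hms := hmd s hs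
  have hpos : 0 < 1 + d s := by linarith
  have hrw : ∀ κ : ℝ, (1 + m) ^ κ * (a s / (1 + d s) ^ κ) =
      a s * ((1 + m) / (1 + d s)) ^ κ := fun κ => by
    rw [Real.div_rpow (by linarith) hpos.le]
    ring
  simp_rw [hrw]
  split_ifs with h
  · simp [h, div_self (by positivity : 1 + m ≠ 0)]
  · have hlt : m < d s := lt_of_le_of_ne hms (Ne.symm h)
    have hbase : 0 ≤ (1 + m) / (1 + d s) := by positivity
    simpa using (tendsto_rpow_atTop_of_base_lt_one _ (by linarith)
      ((div_lt_one hpos).2 (by linarith))).const_mul (a s)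

/-- Let `M` be the set of training samples at minimal distance from the test sample.
Then the predicted claim rate
`ĉ(κ) = (∑ s ∈ S, c s / (1 + d s)^κ) / (∑ s ∈ S, 1 / (1 + d s)^κ)`
converges, as `κ → ∞`, to the arithmetic mean of the claim rates of the samples in `M`. -/
theorem prediction_tendsto_mean_of_nearest
    {ι : Type*} [DecidableEq ι] (S : Finset ι) (hS : S.Nonempty)
    (c d : ι → ℝ) (hd : ∀ s ∈ S, 0 ≤ d s)
    (M : Finset ι) (hM : M = S.filter (fun s => d s = S.inf' hS d)) :
    Tendsto (fun κ : ℝ =>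
        (∑ s ∈ S, c s / (1 + d s) ^ κ) / (∑ s ∈ S, 1 / (1 + d s) ^ κ))
      atTop (nhds ((∑ s ∈ M, c s) / (M.card : ℝ))) := by
  subst hM
  have hm : 0 ≤ S.inf' hS d := Finset.le_inf' hS d hd
  have hmd : ∀ s ∈ S, S.inf' hS d ≤ d s := fun s hs => Finset.inf'_le d hs
  obtain ⟨t, ht, htd⟩ := S.exists_mem_eq_inf' hS d
  have hne : (∑ s ∈ S.filter (fun s => d s = S.inf' hS d), (1 : ℝ)) ≠ 0 := by
    simpa using ⟨t, ht, htd.symm⟩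
  have h := (tendsto_rpow_mul_sum_div_rpow S c d _ hm hmd).div
    (tendsto_rpow_mul_sum_div_rpow S (fun _ => 1) d _ hm hmd) hne
  rw [Finset.sum_const, nsmul_one] at h
  refine h.congr fun κ => ?_
  exact mul_div_mul_left _ _ (Real.rpow_pos_of_pos (by linarith) κ).ne'
end

section
/- Let A and B be disjoint nonempty finite sets of samples with claim rates c : A ∪ B → ℝ, and for w ∈ [0,1] define the single-feature prediction g(w) = (∑_{s∈A} c s + w·∑_{s∈B} c s)/(|A| + w·|B|) (weight 1 on same-category samples A, weight w on other-category samples B). Then for every w ∈ [0,1], g(w) lies (inclusively) between the category mean m_A = (∑_{s∈A} c s)/|A| and the overall mean c̄ = (∑_{s∈A∪B} c s)/(|A|+|B|); that is, min(m_A, c̄) ≤ g(w) ≤ max(m_A, c̄). -/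
/-- For the single-feature predictor `g(w) = (∑ A, c + w ∑ B, c) / (|A| + w |B|)`
with weight `w ∈ [0,1]` on the other-category samples `B`, the prediction lies
between the category mean `m_A` and the overall mean `c̄`. -/
theorem single_feature_prediction_between_means
    {ι : Type*} [DecidableEq ι] (A B : Finset ι) (hA : A.Nonempty) (hB : B.Nonempty)
    (hAB : Disjoint A B) (c : ι → ℝ)
    (w : ℝ) (hw : w ∈ Set.Icc (0 : ℝ) 1)
    (mA cbar : ℝ)
    (hmA : mA = (∑ s ∈ A, c s) / (A.card : ℝ))
    (hcbar : cbar = (∑ s ∈ A ∪ B, c s) / ((A.card : ℝ) + (B.card : ℝ))) :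
    min mA cbar ≤ ((∑ s ∈ A, c s) + w * ∑ s ∈ B, c s) / ((A.card : ℝ) + w * (B.card : ℝ)) ∧
    ((∑ s ∈ A, c s) + w * ∑ s ∈ B, c s) / ((A.card : ℝ) + w * (B.card : ℝ)) ≤ max mA cbar := by
  have ha : (0 : ℝ) < A.card := by exact_mod_cast hA.card_pos
  have hb : (0 : ℝ) < B.card := by exact_mod_cast hB.card_pos
  obtain ⟨hw0, hw1⟩ := hw
  have hD : 0 < (A.card : ℝ) + w * B.card := by positivity
  rw [Finset.sum_union hAB, eq_div_iff (by positivity)] at hcbar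
  rw [eq_div_iff ha.ne'] at hmA
  have hu : 0 ≤ (1 - w) * (A.card : ℝ) := mul_nonneg (sub_nonneg.2 hw1) ha.le
  have hv : 0 ≤ w * ((A.card : ℝ) + B.card) := by positivity
  have hnum : (∑ s ∈ A, c s) + w * ∑ s ∈ B, c s =
      (1 - w) * A.card * mA + w * (A.card + B.card) * cbar := by
    linear_combination -(1 - w) * hmA - w * hcbar
  rw [hnum, le_div_iff₀ hD, div_le_iff₀ hD]
  constructor
  · linarith [mul_le_mul_of_nonneg_left (min_le_left mA cbar) hu,
      mul_le_mul_of_nonneg_left (min_le_right mA cbar) hv]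
  · linarith [mul_le_mul_of_nonneg_left (le_max_left mA cbar) hu,
      mul_le_mul_of_nonneg_left (le_max_right mA cbar) hv]
end

section
/- Let A and B be disjoint nonempty finite sets of samples with claim rates c : A ∪ B → ℝ, let m_A = (∑_{s∈A} c s)/|A| and m_B = (∑_{s∈B} c s)/|B|, and for w ∈ [0,1] define g(w) = (∑_{s∈A} c s + w·∑_{s∈B} c s)/(|A| + w·|B|). If m_B ≥ m_A then g is monotonically nondecreasing on [0,1], and if m_B ≤ m_A then g is monotonically nonincreasing on [0,1]. -/
/-- A linear fractional function with positive denominator is nondecreasing on `[0, ∞)` when its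
coefficients satisfy `p * b ≤ q * a`. -/
theorem monotoneOn_add_mul_div_add_mul {p q a b : ℝ} (ha : 0 < a) (hb : 0 ≤ b)
    (h : p * b ≤ q * a) :
    MonotoneOn (fun w : ℝ => (p + w * q) / (a + w * b)) (Set.Ici 0) := by
  intro x hx y hy hxy
  have hx0 : 0 ≤ x := hx
  have hy0 : 0 ≤ y := hy
  change (p + x * q) / (a + x * b) ≤ (p + y * q) / (a + y * b)
  rw [div_le_div_iff₀ (by positivity) (by positivity)]
  linarith [mul_nonneg (sub_nonneg.2 hxy) (sub_nonneg.2 h)]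

/-- A linear fractional function with positive denominator is nonincreasing on `[0, ∞)` when its
coefficients satisfy `q * a ≤ p * b`. -/
theorem antitoneOn_add_mul_div_add_mul {p q a b : ℝ} (ha : 0 < a) (hb : 0 ≤ b)
    (h : q * a ≤ p * b) :
    AntitoneOn (fun w : ℝ => (p + w * q) / (a + w * b)) (Set.Ici 0) := by
  intro x hx y hy hxy
  have hx0 : 0 ≤ x := hx
  have hy0 : 0 ≤ y := hy
  change (p + y * q) / (a + y * b) ≤ (p + x * q) / (a + x * b)
  rw [div_le_div_iff₀ (by positivity) (by positivity)]
  linarith [mul_nonneg (sub_nonneg.2 hxy) (sub_nonneg.2 h)]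

/-- Monotonicity of the single-feature predictor
`g(w) = (∑ A, c + w ∑ B, c) / (|A| + w |B|)` on `[0,1]`: if the other-category mean
`m_B` is at least the category mean `m_A`, then `g` is nondecreasing; if `m_B ≤ m_A`,
then `g` is nonincreasing. -/
theorem single_feature_prediction_monotone
    {ι : Type*} (A B : Finset ι) (hA : A.Nonempty) (hB : B.Nonempty)
    (hAB : Disjoint A B) (c : ι → ℝ)
    (mA mB : ℝ)
    (hmA : mA = (∑ s ∈ A, c s) / (A.card : ℝ))
    (hmB : mB = (∑ s ∈ B, c s) / (B.card : ℝ))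
    (g : ℝ → ℝ)
    (hg : ∀ w : ℝ, g w =
      ((∑ s ∈ A, c s) + w * ∑ s ∈ B, c s) / ((A.card : ℝ) + w * (B.card : ℝ))) :
    (mA ≤ mB → MonotoneOn g (Set.Icc (0 : ℝ) 1)) ∧
    (mB ≤ mA → AntitoneOn g (Set.Icc (0 : ℝ) 1)) := by
  have ha : (0 : ℝ) < A.card := by exact_mod_cast hA.card_pos
  have hb : (0 : ℝ) < B.card := by exact_mod_cast hB.card_pos
  obtain rfl : g = _ := funext hg
  subst hmA hmB
  rw [div_le_div_iff₀ ha hb, div_le_div_iff₀ hb ha]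
  exact ⟨fun h => (monotoneOn_add_mul_div_add_mul ha hb.le h).mono Set.Icc_subset_Ici_self,
    fun h => (antitoneOn_add_mul_div_add_mul ha hb.le h).mono Set.Icc_subset_Ici_self⟩
end
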